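/- Assume f is bounded from below on ℝ^n and the quadratic penalty function Φ_ρ(x) = 𝕃_ρ(x,0,0) is lower semicontinuous and level-bounded for all sufficiently large ρ. Suppose (λ̄, μ̄) ∈ ℝ^E × ℝ^I supports an exact penalty representation with adequate penalty threshold ρ̄ ∈ (0,∞), i.e., for every ρ ≥ ρ̄ the infimum inf_{x∈ℝ^n} 𝕃_ρ(x,λ̄,μ̄) equals the optimal value F* = inf { f(x) : x feasible for (P) } and the set of minimizers of 𝕃_ρ(·,λ̄,μ̄) equals the set of optimal solutions of (P). Then for every ρ ≥ ρ̄, strong duality holds at that fixed finite penalty parameter: sup_{λ∈ℝ^E, μ∈ℝ^I} inf_{x∈ℝ^n} 𝕃_ρ(x,λ,μ) = inf_{x∈ℝ^n} sup_{λ∈ℝ^E, μ∈ℝ^I} 𝕃_ρ(x,λ,μ), in the extended reals. -/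

import Mathlib

open scoped BigOperators

/-- The Hestenes–Powell–Rockafellar augmented Lagrangian for the nonlinear program
`min f(x) s.t. cE i x = 0 (i ∈ E), cI i x ≤ 0 (i ∈ I)`. -/
noncomputable def AL {n : ℕ} {E I : Type*} [Fintype E] [Fintype I]
    (f : (Fin n → ℝ) → ℝ) (cE : E → (Fin n → ℝ) → ℝ) (cI : I → (Fin n → ℝ) → ℝ)
    (ρ : ℝ) (x : Fin n → ℝ) (lam : E → ℝ) (μ : I → ℝ) : ℝ :=
  f x + ∑ i, lam i * cE i x + (ρ / 2) * ∑ i, (cE i x) ^ 2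
    + (ρ / 2) * ∑ i, ((max (μ i / ρ + cI i x) 0) ^ 2 - (μ i) ^ 2 / ρ ^ 2)

/-- Feasibility for the nonlinear program (P). -/
def Feasible {n : ℕ} {E I : Type*}
    (cE : E → (Fin n → ℝ) → ℝ) (cI : I → (Fin n → ℝ) → ℝ) (x : Fin n → ℝ) : Prop :=
  (∀ i, cE i x = 0) ∧ (∀ i, cI i x ≤ 0)

/-- At a feasible point the augmented Lagrangian never exceeds the objective. -/
theorem AL_le_of_feasible {n : ℕ} {E I : Type*} [Fintype E] [Fintype I]
    {f : (Fin n → ℝ) → ℝ} {cE : E → (Fin n → ℝ) → ℝ} {cI : I → (Fin n → ℝ) → ℝ}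
    {ρ : ℝ} (hρ : 0 ≤ ρ) {x : Fin n → ℝ} (hx : Feasible cE cI x) (lam : E → ℝ) (μ : I → ℝ) :
    AL f cE cI ρ x lam μ ≤ f x := by
  have hsum : ∑ i, ((max (μ i / ρ + cI i x) 0) ^ 2 - (μ i) ^ 2 / ρ ^ 2) ≤ 0 := by
    refine Finset.sum_nonpos fun i _ => ?_
    rw [← div_pow, sub_nonpos]
    have hc := hx.2 i
    rcases le_total (μ i / ρ + cI i x) 0 with h | h
    · simpa [max_eq_right h] using sq_nonneg (μ i / ρ)
    · rw [max_eq_left h]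
      exact pow_le_pow_left₀ h (by linarith) 2
  have hmul := mul_nonpos_of_nonneg_of_nonpos (by positivity : 0 ≤ ρ / 2) hsum
  simp only [AL, hx.1]
  simpa using hmul

/-- If `(λ̄, μ̄)` supports an exact penalty representation with adequate penalty threshold
`ρ̄`, then for every `ρ ≥ ρ̄` strong duality holds at that fixed finite penalty parameter. -/
theorem AL_strong_duality_exact_penalty {n : ℕ} {E I : Type*} [Fintype E] [Fintype I]
    (f : (Fin n → ℝ) → ℝ) (cE : E → (Fin n → ℝ) → ℝ) (cI : I → (Fin n → ℝ) → ℝ)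
    (hbdd : BddBelow (Set.range f))
    (hpen : ∃ ρ₀ : ℝ, 0 < ρ₀ ∧ ∀ ρ : ℝ, ρ₀ ≤ ρ →
      LowerSemicontinuous (fun x => AL f cE cI ρ x 0 0) ∧
      ∀ r : ℝ, Bornology.IsBounded {x : Fin n → ℝ | AL f cE cI ρ x 0 0 ≤ r})
    (lamBar : E → ℝ) (muBar : I → ℝ) (ρbar : ℝ) (hρbar : 0 < ρbar)
    (hexact : ∀ ρ : ℝ, ρbar ≤ ρ →
      (⨅ x : Fin n → ℝ, (AL f cE cI ρ x lamBar muBar : EReal))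
          = (⨅ (x : Fin n → ℝ) (_ : Feasible cE cI x), (f x : EReal)) ∧
      {x : Fin n → ℝ | ∀ y, AL f cE cI ρ x lamBar muBar ≤ AL f cE cI ρ y lamBar muBar}
          = {x : Fin n → ℝ | Feasible cE cI x ∧ ∀ y, Feasible cE cI y → f x ≤ f y}) :
    ∀ ρ : ℝ, ρbar ≤ ρ →
      (⨆ (lam : E → ℝ) (μ : I → ℝ), ⨅ x : Fin n → ℝ, (AL f cE cI ρ x lam μ : EReal))
        = ⨅ x : Fin n → ℝ, ⨆ (lam : E → ℝ) (μ : I → ℝ), (AL f cE cI ρ x lam μ : EReal) := by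
  intro ρ hρ
  apply le_antisymm
  · refine iSup₂_le fun lam μ => le_iInf fun x => ?_
    exact (iInf_le _ x).trans
      (le_iSup₂ (f := fun lam μ => (AL f cE cI ρ x lam μ : EReal)) lam μ)
  · calc (⨅ x : Fin n → ℝ, ⨆ (lam : E → ℝ) (μ : I → ℝ), (AL f cE cI ρ x lam μ : EReal))
        ≤ ⨅ (x : Fin n → ℝ) (_ : Feasible cE cI x), (f x : EReal) :=
          le_iInf₂ fun x hx => (iInf_le _ x).trans <| iSup₂_le fun lam μ =>
            EReal.coe_le_coe_iff.mpr
              (AL_le_of_feasible (hρbar.le.trans hρ) hx lam μ)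
      _ = ⨅ x : Fin n → ℝ, (AL f cE cI ρ x lamBar muBar : EReal) := (hexact ρ hρ).1.symm
      _ ≤ _ := le_iSup₂
          (f := fun lam μ => ⨅ x : Fin n → ℝ, (AL f cE cI ρ x lam μ : EReal)) lamBar muBar
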